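/- Let j ∈ [2,n] (i.e., 2 ≤ j ≤ n). Then (1 + s_{j−1}) · (t_j − (t_{j−1} − 1)) = 0 in k[S_n] (where s_{j−1} is viewed as an element of the group algebra). -/

import Mathlib

/-- The simple transposition `s_i ∈ S_n` (1-based indexing), swapping `i` and `i+1`,
defined as the identity for `i` outside `{1, …, n-1}`. -/
def simpleTransposition (n i : ℕ) : Equiv.Perm (Fin n) :=
  if h : 1 ≤ i ∧ i < n then
    Equiv.swap ⟨i - 1, by omega⟩ ⟨i, h.2⟩
  else 1

/-- The cycle `(v ⟹ w) = s_v s_{v+1} ⋯ s_{w-1} ∈ S_n`, sending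
`v ↦ v+1 ↦ ⋯ ↦ w ↦ v` (and equal to the identity when `v = w`). -/
def cyc (n v w : ℕ) : Equiv.Perm (Fin n) :=
  ((List.range' v (w - v)).map (simpleTransposition n)).prod

/-- The somewhere-to-below shuffle `t_ℓ = Σ_{w=ℓ}^{n} (ℓ ⟹ w)` in the group
algebra `R[S_n]`. -/
noncomputable def t (R : Type*) [CommRing R] (n ℓ : ℕ) :
    MonoidAlgebra R (Equiv.Perm (Fin n)) :=
  ∑ w ∈ Finset.Icc ℓ n, MonoidAlgebra.of R (Equiv.Perm (Fin n)) (cyc n ℓ w)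

theorem simpleTransposition_mul_self (n i : ℕ) :
    simpleTransposition n i * simpleTransposition n i = 1 := by
  unfold simpleTransposition
  split_ifs <;> simp

theorem cyc_self (n v : ℕ) : cyc n v v = 1 := by
  simp [cyc]

theorem cyc_eq_mul_cyc_succ (n : ℕ) {v w : ℕ} (h : v < w) :
    cyc n v w = simpleTransposition n v * cyc n (v + 1) w := by
  obtain ⟨d, rfl⟩ := Nat.exists_eq_add_of_lt h
  have h₁ : v + d + 1 - v = d + 1 := by omega
  have h₂ : v + d + 1 - (v + 1) = d := by omega
  simp [cyc, h₁, h₂, List.range'_succ]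

theorem t_eq_one_add_mul_t_succ (R : Type*) [CommRing R] {n l : ℕ} (h : l ≤ n) :
    t R n l =
      1 + MonoidAlgebra.of R (Equiv.Perm (Fin n)) (simpleTransposition n l) * t R n (l + 1) := by
  rw [t, t, ← Finset.add_sum_Ioc_eq_sum_Icc h, cyc_self, map_one, Finset.mul_sum,
    ← Finset.Icc_add_one_left_eq_Ioc]
  congr 1
  refine Finset.sum_congr rfl fun w hw => ?_
  rw [cyc_eq_mul_cyc_succ n (Finset.mem_Icc.mp hw).1, map_mul]

theorem one_plus_s_jm1_mul_eq_zero
    (R : Type*) [CommRing R] (n : ℕ) (hn : 0 < n)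
    (j : ℕ) (hj2 : 2 ≤ j) (hjn : j ≤ n) :
    (1 + MonoidAlgebra.of R (Equiv.Perm (Fin n)) (simpleTransposition n (j - 1))) *
      (t R n j - (t R n (j - 1) - 1)) = 0 := by
  have hs : MonoidAlgebra.of R (Equiv.Perm (Fin n)) (simpleTransposition n (j - 1)) *
      MonoidAlgebra.of R (Equiv.Perm (Fin n)) (simpleTransposition n (j - 1)) = 1 := by
    rw [← map_mul, simpleTransposition_mul_self, map_one]
  rw [t_eq_one_add_mul_t_succ R (by omega : j - 1 ≤ n), Nat.sub_add_cancel (by omega : 1 ≤ j),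
    add_sub_cancel_left, add_mul, one_mul, mul_sub, ← mul_assoc, hs, one_mul]
  abel
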